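/- arXiv:2405.02202 — 13 statements merged into one kernel-verified Lean document; each statement's English description precedes it below -/
import Mathlib

section
/- Let G be a finite simple graph with at least one vertex and let m ≥ 2 be an integer. If G is Z_m-AW (every labeling of G by elements of Z_m is winnable in the Z_m-labeling lights out game), then m = 2^k for some integer k ≥ 1. -/
-- Toggling a vertex `v` in the `ZMod m`-labeling lights out game:
-- the label of `v` is added to the labels of `v` and all its neighbors.
open Classical in
noncomputable def gToggle {V : Type*} (G : SimpleGraph V) {m : ℕ} (v : V)
    (lab : V → ZMod m) : V → ZMod m :=
  fun w => if w = v ∨ G.Adj v w then lab v + lab w else lab w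

/-- The result of toggling, in order, the vertices in the list `L`
in the `ZMod m`-labeling lights out game. -/
noncomputable def gPlay {V : Type*} (G : SimpleGraph V) {m : ℕ} (L : List V)
    (lab : V → ZMod m) : V → ZMod m :=
  L.foldl (fun l v => gToggle G v l) lab

/-- A labeling is winnable in the `ZMod m`-labeling lights out game if some
finite sequence of toggles transforms it into the zero labeling. -/
def gWinnable {V : Type*} (G : SimpleGraph V) {m : ℕ} (lab : V → ZMod m) : Prop :=
  ∃ L : List V, gPlay G L lab = 0

/-- `G` is `ZMod m`-Always Winnable: every labeling is winnable
in the `ZMod m`-labeling lights out game. -/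
def gAW {V : Type*} (G : SimpleGraph V) (m : ℕ) : Prop :=
  ∀ lab : V → ZMod m, gWinnable G lab

-- Toggling a vertex `v` in the neighborhood `m`-lights out game:
-- the labels of `v` and all its neighbors are increased by `1`.
open Classical in
noncomputable def nToggle {V : Type*} (G : SimpleGraph V) {m : ℕ} (v : V)
    (lab : V → ZMod m) : V → ZMod m :=
  fun w => if w = v ∨ G.Adj v w then lab w + 1 else lab w

/-- The result of toggling, in order, the vertices in the list `L`
in the neighborhood `m`-lights out game. -/
noncomputable def nPlay {V : Type*} (G : SimpleGraph V) {m : ℕ} (L : List V)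
    (lab : V → ZMod m) : V → ZMod m :=
  L.foldl (fun l v => nToggle G v l) lab

/-- A labeling is `(N,m)`-winnable if some finite sequence of toggles in the
neighborhood `m`-lights out game transforms it into the zero labeling. -/
def nWinnable {V : Type*} (G : SimpleGraph V) {m : ℕ} (lab : V → ZMod m) : Prop :=
  ∃ L : List V, nPlay G L lab = 0

/-- `G` is `(N,m)`-Always Winnable: every labeling is winnable
in the neighborhood `m`-lights out game. -/
def nAW {V : Type*} (G : SimpleGraph V) (m : ℕ) : Prop :=
  ∀ lab : V → ZMod m, nWinnable G lab

/-- The parity of an element of `ZMod n`, as an element of `ZMod 2`: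
`1` if its representatives are odd, `0` if they are even. -/
def parity {n : ℕ} (x : ZMod n) : ZMod 2 :=
  if x.val % 2 = 1 then 1 else 0

/-- For an odd prime divisor `p` of `m`, if all labels vanish modulo `p` after a toggle
then they did before it. -/
theorem castHom_eq_zero_of_gToggle {V : Type*} (G : SimpleGraph V) {m p : ℕ} [Fact p.Prime]
    (hodd : Odd p) (hpm : p ∣ m) (v : V) (lab : V → ZMod m)
    (h : ∀ w, ZMod.castHom hpm (ZMod p) (gToggle G v lab w) = 0) (w : V) :
    ZMod.castHom hpm (ZMod p) (lab w) = 0 := by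
  have two_ne : (2 : ZMod p) ≠ 0 := by
    intro h2
    have hdvd : p ∣ 2 := (ZMod.natCast_eq_zero_iff 2 p).1 (by exact_mod_cast h2)
    rw [(Nat.prime_dvd_prime_iff_eq Fact.out Nat.prime_two).1 hdvd] at hodd
    exact absurd hodd (by decide)
  have hv : ZMod.castHom hpm (ZMod p) (lab v) = 0 := by
    have := h v
    simp only [gToggle, true_or, if_true, map_add] at this
    rw [← two_mul] at this
    exact (mul_eq_zero.1 this).resolve_left two_ne
  have hw := h w
  unfold gToggle at hw
  split_ifs at hw
  · rwa [map_add, hv, zero_add] at hw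
  · exact hw

/-- For an odd prime divisor `p` of `m`, every winnable labeling vanishes modulo `p`. -/
theorem castHom_eq_zero_of_gWinnable {V : Type*} (G : SimpleGraph V) {m p : ℕ} [Fact p.Prime]
    (hodd : Odd p) (hpm : p ∣ m) (lab : V → ZMod m) (h : gWinnable G lab) (w : V) :
    ZMod.castHom hpm (ZMod p) (lab w) = 0 := by
  obtain ⟨L, hL⟩ := h
  induction L generalizing lab w with
  | nil =>
    have : lab = 0 := hL
    rw [this, Pi.zero_apply, map_zero]
  | cons v L ih =>
    exact castHom_eq_zero_of_gToggle G hodd hpm v lab (fun u => ih _ u hL) w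

theorem stmt0 {V : Type*} [Fintype V] [Nonempty V] (G : SimpleGraph V)
    (m : ℕ) (hm : 2 ≤ m) (hAW : gAW G m) :
    ∃ k : ℕ, 1 ≤ k ∧ m = 2 ^ k := by
  rcases Nat.eq_two_pow_or_exists_odd_prime_and_dvd m with ⟨k, hk⟩ | ⟨p, hp, hpm, hodd⟩
  · refine ⟨k, Nat.one_le_iff_ne_zero.2 ?_, hk⟩
    rintro rfl
    omega
  · have : Fact p.Prime := ⟨hp⟩
    have h := castHom_eq_zero_of_gWinnable G hodd hpm 1 (hAW 1) (Classical.arbitrary V)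
    rw [Pi.one_apply, map_one] at h
    exact absurd h one_ne_zero
end

section
/- Let G be a finite simple graph, let k ≥ 1, let λ: V(G) → Z_{2^k} be a labeling, and let λ₂: V(G) → Z_2 be its parity labeling. If λ₂ is Z_2-winnable, then starting the Z_{2^k}-labeling lights out game from the labeling λ, it is possible to toggle vertices of G so that the resulting labeling assigns an even label to every vertex. -/
theorem gPlay_map {V : Type*} (G : SimpleGraph V) {m n : ℕ} (f : ZMod m →+ ZMod n)
    (L : List V) (lab : V → ZMod m) :
    gPlay G L (fun w => f (lab w)) = fun w => f (gPlay G L lab w) := by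
  induction L generalizing lab with
  | nil => rfl
  | cons v L ih =>
    have h : gToggle G v (fun w => f (lab w)) = fun w => f (gToggle G v lab w) := by
      funext w
      unfold gToggle
      split_ifs <;> simp
    simp only [gPlay, List.foldl_cons, h] at ih ⊢
    exact ih _

theorem parity_eq_natCast_val {n : ℕ} (x : ZMod n) : parity x = (x.val : ZMod 2) := by
  rw [parity]
  split_ifs with h
  · exact ((ZMod.natCast_eq_one_iff_odd).2 (Nat.odd_iff.2 h)).symm
  · exact ((ZMod.natCast_eq_zero_iff_even).2 (Nat.even_iff.2 (by lia))).symm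

theorem parity_eq_castHom {n : ℕ} [NeZero n] (h : 2 ∣ n) (x : ZMod n) :
    parity x = ZMod.castHom h (ZMod 2) x := by
  rw [parity_eq_natCast_val, ZMod.castHom_apply, ZMod.natCast_val]

theorem stmt2 {V : Type*} [Fintype V] (G : SimpleGraph V) (k : ℕ) (hk : 1 ≤ k)
    (lab : V → ZMod (2 ^ k))
    (hwin : gWinnable G (fun w => parity (lab w))) :
    ∃ L : List V, ∀ w : V, Even ((gPlay G L lab w).val) := by
  obtain ⟨L, hL⟩ := hwin
  have h2 : 2 ∣ 2 ^ k := dvd_pow_self 2 (by lia)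
  refine ⟨L, fun w => ?_⟩
  simp only [parity_eq_castHom h2] at hL
  have hw := congrFun ((gPlay_map G (ZMod.castHom h2 (ZMod 2)).toAddMonoidHom L lab).symm.trans hL) w
  rw [← ZMod.natCast_eq_zero_iff_even, ← parity_eq_natCast_val, parity_eq_castHom h2]
  exact hw
end

section
/- Let G be a finite simple graph and let k ≥ 2. Suppose λ: V(G) → Z_{2^k} is a labeling in which every vertex has an even label, and define π: V(G) → Z_{2^{k-1}} by π(w) = (1/2)λ(w) for all w ∈ V(G) (halving each even residue). If toggling a vertex v in the Z_{2^k}-labeling lights out game with labeling λ yields the labeling λ', then toggling v in the Z_{2^{k-1}}-labeling lights out game with labeling π yields the labeling π' satisfying π'(w) = (1/2)λ'(w) for all w ∈ V(G). -/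
/-- Halving is additive on the even elements of `ZMod (2 * n)`, with values in `ZMod n`. -/
theorem natCast_half_val_add {n : ℕ} [NeZero n] (a b : ZMod (2 * n))
    (ha : Even a.val) (hb : Even b.val) :
    (((a + b).val / 2 : ℕ) : ZMod n) = ((a.val / 2 : ℕ) : ZMod n) + ((b.val / 2 : ℕ) : ZMod n) := by
  obtain ⟨x, hx⟩ := ha
  obtain ⟨y, hy⟩ := hb
  rw [ZMod.val_add, hx, hy, show x + x + (y + y) = 2 * (x + y) by ring, Nat.mul_mod_mul_left,
    Nat.mul_div_cancel_left _ two_pos, ZMod.natCast_mod, Nat.cast_add,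
    show (x + x) / 2 = x by lia, show (y + y) / 2 = y by lia]

theorem stmt3 {V : Type*} [Fintype V] (G : SimpleGraph V) (k : ℕ) (hk : 2 ≤ k)
    (lab : V → ZMod (2 ^ k)) (heven : ∀ w : V, Even ((lab w).val))
    (piLab : V → ZMod (2 ^ (k - 1)))
    (hpi : ∀ w : V, piLab w = (((lab w).val / 2 : ℕ) : ZMod (2 ^ (k - 1))))
    (v : V) (lab' : V → ZMod (2 ^ k)) (h : lab' = gToggle G v lab) :
    ∀ w : V, gToggle G v piLab w = (((lab' w).val / 2 : ℕ) : ZMod (2 ^ (k - 1))) := by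
  obtain ⟨j, rfl⟩ : ∃ j, k = j + 1 := ⟨k - 1, by lia⟩
  have half_add : ∀ a b : ZMod (2 ^ (j + 1)), Even a.val → Even b.val →
      (((a + b).val / 2 : ℕ) : ZMod (2 ^ j)) =
        ((a.val / 2 : ℕ) : ZMod (2 ^ j)) + ((b.val / 2 : ℕ) : ZMod (2 ^ j)) := by
    rw [pow_succ']
    exact natCast_half_val_add
  intro w
  subst h
  unfold gToggle
  split_ifs
  · rw [hpi, hpi]
    exact (half_add _ _ (heven v) (heven w)).symm
  · exact hpi w
end

section
/- Let G be a finite simple graph. If G is Z_2-AW (every labeling by Z_2 is winnable in the Z_2-labeling lights out game), then G is (N,2)-AW (every labeling by Z_2 is winnable in the neighborhood 2-lights out game). -/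
/-- Over `ZMod 2`, toggling a vertex in the labeling game either changes nothing or agrees with
toggling that vertex in the neighborhood game. -/
theorem gToggle_eq_self_or_eq_nToggle {V : Type*} (G : SimpleGraph V) (v : V)
    (lab : V → ZMod 2) : gToggle G v lab = lab ∨ gToggle G v lab = nToggle G v lab := by
  have hv : ∀ x : ZMod 2, x = 0 ∨ x = 1 := by decide
  rcases hv (lab v) with h | h
  · left
    funext w
    simp [gToggle, h]
  · right
    funext w
    simp [gToggle, nToggle, h, add_comm]

/-- A labeling that some play of the `ZMod 2`-labeling game takes to zero is winnable in the
neighborhood game. -/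
theorem nWinnable_of_gPlay_eq_zero {V : Type*} (G : SimpleGraph V) (L : List V)
    (lab : V → ZMod 2) (h : gPlay G L lab = 0) : nWinnable G lab := by
  induction L generalizing lab with
  | nil => exact ⟨[], h⟩
  | cons v L ih =>
    have hw : nWinnable G (gToggle G v lab) := ih _ h
    rcases gToggle_eq_self_or_eq_nToggle G v lab with hv | hv
    · rwa [hv] at hw
    · rw [hv] at hw
      obtain ⟨M, hM⟩ := hw
      exact ⟨v :: M, hM⟩

theorem stmt5 {V : Type*} [Fintype V] (G : SimpleGraph V) (h : gAW G 2) :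
    nAW G 2 := by
  intro lab
  obtain ⟨L, hL⟩ := h lab
  exact nWinnable_of_gPlay_eq_zero G L lab hL
end

section
/- Let n, p ≥ 1 and m ≥ 2, and consider the neighborhood m-lights out game on the complete bipartite graph K_{n,p} with parts P_1 and P_2, where |P_1| = n and |P_2| = p. For any initial labeling of V(K_{n,p}) by Z_m, one can toggle vertices so that in the resulting labeling every vertex in P_1 has label 0 and all vertices in P_2 have the same label. -/
open Classical in
theorem nPlay_replicate {V : Type*} (G : SimpleGraph V) {m : ℕ} (k : ℕ) (v : V)
    (lab : V → ZMod m) (w : V) :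
    nPlay G (List.replicate k v) lab w = lab w + if w = v ∨ G.Adj v w then (k : ZMod m) else 0 := by
  induction k generalizing lab with
  | zero => simp [nPlay]
  | succ k ih =>
    change nPlay G (List.replicate k v) (nToggle G v lab) w = _
    rw [ih, nToggle]
    split_ifs
    · push_cast; ring
    · rfl

theorem nPlay_append {V : Type*} (G : SimpleGraph V) {m : ℕ} (L M : List V)
    (lab : V → ZMod m) : nPlay G (L ++ M) lab = nPlay G M (nPlay G L lab) :=
  List.foldl_append

open Classical in
theorem nPlay_flatMap_replicate {V : Type*} (G : SimpleGraph V) {m : ℕ} (x : V → ℕ) (L : List V)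
    (lab : V → ZMod m) (w : V) :
    nPlay G (L.flatMap fun v => List.replicate (x v) v) lab w =
      lab w + (L.map fun v => if w = v ∨ G.Adj v w then (x v : ZMod m) else 0).sum := by
  induction L generalizing lab with
  | nil => simp [nPlay]
  | cons v L ih =>
    rw [List.flatMap_cons, nPlay_append, ih, nPlay_replicate, List.map_cons, List.sum_cons,
      add_assoc]

open Classical in
/-- Any assignment of toggle multiplicities in `ZMod m` is realized by a sequence of toggles. -/
theorem exists_nPlay_eq {V : Type*} [Fintype V] (G : SimpleGraph V) {m : ℕ} [NeZero m]
    (x : V → ZMod m) (lab : V → ZMod m) :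
    ∃ L : List V, ∀ w, nPlay G L lab w = lab w + ∑ v, if w = v ∨ G.Adj v w then x v else 0 := by
  refine ⟨Finset.univ.toList.flatMap fun v => List.replicate (x v).val v, fun w => ?_⟩
  rw [nPlay_flatMap_replicate, Finset.sum_map_toList]
  simp only [ZMod.natCast_zmod_val]

theorem stmt6 (n p m : ℕ) (hn : 1 ≤ n) (hp : 1 ≤ p) (hm : 2 ≤ m)
    (lab : Fin n ⊕ Fin p → ZMod m) :
    ∃ L : List (Fin n ⊕ Fin p),
      (∀ i : Fin n,
        nPlay (completeBipartiteGraph (Fin n) (Fin p)) L lab (Sum.inl i) = 0) ∧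
      (∃ c : ZMod m, ∀ j : Fin p,
        nPlay (completeBipartiteGraph (Fin n) (Fin p)) L lab (Sum.inr j) = c) := by
  have : NeZero m := ⟨by omega⟩
  obtain ⟨L, hL⟩ := exists_nPlay_eq (completeBipartiteGraph (Fin n) (Fin p))
    (Sum.elim (fun i => -lab (.inl i) + ∑ j, lab (.inr j)) fun j => -lab (.inr j)) lab
  refine ⟨L, fun i => ?_, ∑ i, (-lab (.inl i) + ∑ j, lab (.inr j)), fun j => ?_⟩
  · rw [hL]
    simp
  · rw [hL]
    simp
end

section
/- Let n, p ≥ 1 and m ≥ 2, and consider the neighborhood m-lights out game on the complete bipartite graph K_{n,p} with parts P_1 and P_2, where |P_1| = n and |P_2| = p. Suppose λ is an (N,m)-winnable labeling in which all vertices of P_1 have the same label. Then in any winning sequence of toggles for λ, every vertex of P_1 is toggled the same number of times modulo m. -/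
instance Sum.instLawfulBEq {α β : Type*} [BEq α] [BEq β] [LawfulBEq α] [LawfulBEq β] :
    LawfulBEq (α ⊕ β) where
  rfl {x} := by
    cases x with
    | inl a => exact beq_self_eq_true a
    | inr b => exact beq_self_eq_true b
  eq_of_beq {x y} h := by
    rcases x with a | a <;> rcases y with b | b
    · exact congrArg Sum.inl (eq_of_beq (show (a == b) = true from h))
    · exact absurd h Bool.false_ne_true
    · exact absurd h Bool.false_ne_true
    · exact congrArg Sum.inr (eq_of_beq (show (a == b) = true from h))

/-- In the neighborhood game on a complete bipartite graph, a vertex of the left part is increased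
once for each of its own toggles and once for each toggle in the right part. -/
lemma nPlay_completeBipartiteGraph_inl {α β : Type*} [DecidableEq α] [DecidableEq β] {m : ℕ}
    (L : List (α ⊕ β)) (lab : α ⊕ β → ZMod m) (a : α) :
    nPlay (completeBipartiteGraph α β) L lab (Sum.inl a) =
      lab (Sum.inl a) + L.count (Sum.inl a) + L.countP Sum.isRight := by
  induction L generalizing lab with
  | nil => simp [nPlay]
  | cons v L ih =>
    change nPlay _ L (nToggle _ v lab) _ = _
    rw [ih, List.count_cons, List.countP_cons]
    rcases v with b | b
    · by_cases h : a = b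
      · simp [nToggle, h]
        ring
      · simp [nToggle, h, Ne.symm h]
    · simp [nToggle]
      ring

theorem stmt7 (n p m : ℕ) (hn : 1 ≤ n) (hp : 1 ≤ p) (hm : 2 ≤ m)
    (lab : Fin n ⊕ Fin p → ZMod m)
    (hsame : ∃ c : ZMod m, ∀ i : Fin n, lab (Sum.inl i) = c)
    (hwin : nWinnable (completeBipartiteGraph (Fin n) (Fin p)) lab)
    (L : List (Fin n ⊕ Fin p))
    (hL : nPlay (completeBipartiteGraph (Fin n) (Fin p)) L lab = 0) :
    ∀ i j : Fin n, L.count (Sum.inl i) ≡ L.count (Sum.inl j) [MOD m] := by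
  obtain ⟨c, hc⟩ := hsame
  intro i j
  have hi := congrFun hL (Sum.inl i)
  have hj := congrFun hL (Sum.inl j)
  rw [nPlay_completeBipartiteGraph_inl, hc] at hi hj
  rw [← ZMod.natCast_eq_natCast_iff]
  exact add_left_cancel (add_right_cancel (hi.trans hj.symm))
end

section
/- Let n, p ≥ 1 and m ≥ 2. The complete bipartite graph K_{n,p} is (N,m)-AW if and only if gcd(m, np − 1) = 1. -/
/-- Playing a list of toggles adds to the label of `w` the number of toggles made in the
closed neighborhood of `w`. -/
theorem nPlay_apply {V : Type*} [Fintype V] [DecidableEq V] (G : SimpleGraph V)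
    [DecidableRel G.Adj] {m : ℕ} (L : List V) (lab : V → ZMod m) (w : V) :
    nPlay G L lab w =
      lab w + ∑ v, if w = v ∨ G.Adj v w then (L.count v : ZMod m) else 0 := by
  induction L generalizing lab with
  | nil => simp [nPlay]
  | cons a L ih =>
    have hplay : nPlay G (a :: L) lab = nPlay G L (nToggle G a lab) := rfl
    have hsum : (∑ v, if w = v ∨ G.Adj v w then ((a :: L).count v : ZMod m) else 0) =
        (∑ v, if w = v ∨ G.Adj v w then (L.count v : ZMod m) else 0) +
          if w = a ∨ G.Adj a w then 1 else 0 := by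
      have hsingle : (∑ v, if a = v then if w = v ∨ G.Adj v w then (1 : ZMod m) else 0 else 0) =
          if w = a ∨ G.Adj a w then 1 else 0 := by simp
      rw [← hsingle, ← Finset.sum_add_distrib]
      refine Finset.sum_congr rfl fun v _ => ?_
      by_cases hv : a = v <;> by_cases hw : w = v ∨ G.Adj v w <;>
        simp [hv, hw]
    rw [hplay, ih, hsum]
    by_cases hw : w = a ∨ G.Adj a w <;> simp only [nToggle, hw, if_true, if_false] <;> ring

/-- Winnability is solvability of the linear system over `ZMod m` whose unknowns are the numbers
of toggles of each vertex. -/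
theorem nWinnable_iff_exists {V : Type*} [Fintype V] [DecidableEq V] (G : SimpleGraph V)
    [DecidableRel G.Adj] {m : ℕ} [NeZero m] (lab : V → ZMod m) :
    nWinnable G lab ↔
      ∃ x : V → ZMod m, ∀ w, lab w + ∑ v, (if w = v ∨ G.Adj v w then x v else 0) = 0 := by
  constructor
  · rintro ⟨L, hL⟩
    exact ⟨fun v => L.count v, fun w => by rw [← nPlay_apply, hL, Pi.zero_apply]⟩
  · rintro ⟨x, hx⟩
    refine ⟨(∑ v, (x v).val • ({v} : Multiset V)).toList, funext fun w => ?_⟩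
    have hcount (v : V) :
        (∑ v, (x v).val • ({v} : Multiset V)).toList.count v = (x v).val := by
      rw [← Multiset.coe_count, Multiset.coe_toList, Multiset.count_sum']
      simp [Multiset.count_singleton]
    simpa [nPlay_apply, hcount] using hx w

/-- Winnability on a complete bipartite graph, with the numbers of toggles on the two sides
as unknowns. -/
theorem nWinnable_completeBipartiteGraph_iff {α β : Type*} [Fintype α] [Fintype β]
    {m : ℕ} [NeZero m] (lab : α ⊕ β → ZMod m) :
    nWinnable (completeBipartiteGraph α β) lab ↔
      ∃ (a : α → ZMod m) (b : β → ZMod m),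
        (∀ i, lab (.inl i) + (a i + ∑ j, b j) = 0) ∧
          ∀ j, lab (.inr j) + (∑ i, a i + b j) = 0 := by
  classical
  rw [nWinnable_iff_exists]
  constructor
  · rintro ⟨x, hx⟩
    refine ⟨x ∘ .inl, x ∘ .inr, fun i => ?_, fun j => ?_⟩
    · simpa using hx (.inl i)
    · simpa using hx (.inr j)
  · rintro ⟨a, b, ha, hb⟩
    refine ⟨Sum.elim a b, ?_⟩
    rintro (i | j)
    · simpa using ha i
    · simpa using hb j

/-- A complete bipartite graph is always winnable exactly when the product of the sizes of its
sides, minus one, is invertible modulo `m`. -/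
theorem nAW_completeBipartiteGraph_iff_isUnit {α β : Type*} [Fintype α] [Fintype β] [Nonempty α]
    {m : ℕ} [NeZero m] :
    nAW (completeBipartiteGraph α β) m ↔
      IsUnit ((Fintype.card α : ZMod m) * Fintype.card β - 1) := by
  classical
  simp only [nAW, nWinnable_completeBipartiteGraph_iff]
  constructor
  · intro h
    obtain ⟨i₀⟩ := ‹Nonempty α›
    obtain ⟨a, b, ha, hb⟩ := h (Pi.single (.inl i₀) 1)
    have hsa := Finset.sum_eq_zero fun i (_ : i ∈ Finset.univ) => ha i
    have hsb := Finset.sum_eq_zero fun j (_ : j ∈ Finset.univ) => hb j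
    simp [Finset.sum_add_distrib, Pi.single_apply] at hsa hsb
    exact .of_mul_eq_one (∑ i, a i) (by linear_combination Fintype.card α * hsb - hsa)
  · intro h lab
    obtain ⟨u, hu⟩ := h.exists_right_inv
    set A := ∑ i, lab (.inl i) with hA
    set B := ∑ j, lab (.inr j) with hB
    have hsa : ∑ i, (-lab (.inl i) - u * (B - Fintype.card β * A)) =
        u * (A - Fintype.card α * B) := by
      simp only [Finset.sum_sub_distrib, Finset.sum_neg_distrib, ← hA, Finset.sum_const,
        Finset.card_univ, nsmul_eq_mul]
      linear_combination A * hu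
    have hsb : ∑ j, (-lab (.inr j) - u * (A - Fintype.card α * B)) =
        u * (B - Fintype.card β * A) := by
      simp only [Finset.sum_sub_distrib, Finset.sum_neg_distrib, ← hB, Finset.sum_const,
        Finset.card_univ, nsmul_eq_mul]
      linear_combination B * hu
    refine ⟨fun i => -lab (.inl i) - u * (B - Fintype.card β * A),
      fun j => -lab (.inr j) - u * (A - Fintype.card α * B), fun i => ?_, fun j => ?_⟩
    · rw [hsb]; ring
    · rw [hsa]; ring

theorem stmt8 (n p m : ℕ) (hn : 1 ≤ n) (hp : 1 ≤ p) (hm : 2 ≤ m) :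
    nAW (completeBipartiteGraph (Fin n) (Fin p)) m ↔ Nat.gcd m (n * p - 1) = 1 := by
  have : NeZero m := ⟨by omega⟩
  have : Nonempty (Fin n) := ⟨⟨0, hn⟩⟩
  have hcast : ((n : ZMod m) * p - 1) = ((n * p - 1 : ℕ) : ZMod m) := by
    rw [Nat.cast_sub (Nat.mul_pos hn hp)]
    push_cast
    rfl
  rw [nAW_completeBipartiteGraph_iff_isUnit, Fintype.card_fin, Fintype.card_fin, hcast,
    ZMod.isUnit_iff_coprime, Nat.coprime_comm, Nat.coprime_iff_gcd_eq_one]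
end

section
/- Let n, p ≥ 1 and k ≥ 1. If the complete bipartite graph K_{n,p} is Z_{2^k}-AW, then at least one of n and p is even. -/
open Classical in
/-- Toggling `v` increases the sum of all labels by `deg v + 1` times the label of `v`. -/
theorem sum_gToggle {V : Type*} [Fintype V] (G : SimpleGraph V) {m : ℕ} (v : V)
    (lab : V → ZMod m) :
    ∑ w, gToggle G v lab w = (G.degree v + 1) * lab v + ∑ w, lab w := by
  have hterm (w : V) : gToggle G v lab w =
      ((if w = v then lab v else 0) + if G.Adj v w then lab v else 0) + lab w := by
    by_cases hwv : w = v
    · subst hwv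
      simp [gToggle]
    · simp only [gToggle, hwv, false_or, if_false]
      split_ifs <;> simp
  simp only [hterm, Finset.sum_add_distrib, Finset.sum_ite_eq', Finset.mem_univ, if_true]
  rw [← Finset.sum_filter, Finset.sum_const, ← SimpleGraph.neighborFinset_eq_filter,
    SimpleGraph.card_neighborFinset_eq_degree, nsmul_eq_mul]
  ring

open Classical in
/-- If all degrees are odd, then play preserves the sum of all labels modulo `2`. -/
theorem map_sum_gPlay {V : Type*} [Fintype V] (G : SimpleGraph V) {m : ℕ}
    (hdeg : ∀ v, Odd (G.degree v)) (f : ZMod m →+* ZMod 2) (L : List V) (lab : V → ZMod m) :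
    f (∑ w, gPlay G L lab w) = f (∑ w, lab w) := by
  induction L generalizing lab with
  | nil => rfl
  | cons v L ih =>
    have heven : ((G.degree v + 1 : ℕ) : ZMod 2) = 0 :=
      (ZMod.natCast_eq_zero_iff_even).2 (hdeg v).add_one
    push_cast at heven
    calc f (∑ w, gPlay G (v :: L) lab w) = f (∑ w, gToggle G v lab w) := ih _
      _ = f (∑ w, lab w) := by
        rw [sum_gToggle, map_add, map_mul, map_add, map_natCast, map_one, heven, zero_mul,
          zero_add]

open Classical in
/-- A nonempty graph whose degrees are all odd is not `ZMod m`-always winnable for even `m`. -/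
theorem not_gAW_of_odd_degree {V : Type*} [Fintype V] [Nonempty V] (G : SimpleGraph V) {m : ℕ}
    (hm : 2 ∣ m) (hdeg : ∀ v, Odd (G.degree v)) : ¬ gAW G m := by
  intro hAW
  obtain ⟨v⟩ := ‹Nonempty V›
  obtain ⟨L, hL⟩ := hAW (Pi.single v 1)
  have hsum := map_sum_gPlay G hdeg (ZMod.castHom hm (ZMod 2)) L (Pi.single v 1)
  rw [hL, Finset.sum_pi_single', if_pos (Finset.mem_univ v), map_one] at hsum
  simp at hsum

open Classical in
theorem degree_completeBipartiteGraph_inl {V W : Type*} [Fintype V] [Fintype W] (v : V) :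
    (completeBipartiteGraph V W).degree (Sum.inl v) = Fintype.card W := by
  rw [← SimpleGraph.card_neighborFinset_eq_degree, SimpleGraph.neighborFinset_eq_filter,
    Finset.card_filter, Fintype.sum_sum_type]
  simp

open Classical in
theorem degree_completeBipartiteGraph_inr {V W : Type*} [Fintype V] [Fintype W] (w : W) :
    (completeBipartiteGraph V W).degree (Sum.inr w) = Fintype.card V := by
  rw [← SimpleGraph.card_neighborFinset_eq_degree, SimpleGraph.neighborFinset_eq_filter,
    Finset.card_filter, Fintype.sum_sum_type]
  simp

theorem stmt9 (n p k : ℕ) (hn : 1 ≤ n) (hp : 1 ≤ p) (hk : 1 ≤ k)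
    (hAW : gAW (completeBipartiteGraph (Fin n) (Fin p)) (2 ^ k)) :
    Even n ∨ Even p := by
  classical
  by_contra! h
  simp only [Nat.not_even_iff_odd] at h
  have : Nonempty (Fin n ⊕ Fin p) := ⟨Sum.inl ⟨0, hn⟩⟩
  refine not_gAW_of_odd_degree _ (dvd_pow_self 2 (by omega)) ?_ hAW
  rintro (v | w)
  · convert h.2
    simpa using degree_completeBipartiteGraph_inl (W := Fin p) v
  · convert h.1
    simpa using degree_completeBipartiteGraph_inr (V := Fin n) w
end

section
/- Let n ≥ 1 and k ≥ 1. If the path graph P_n is Z_{2^k}-AW, then n ≡ 0 or 1 (mod 3). -/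
/-- If the weights `c` sum to zero over every closed neighborhood, then the weighted sum of
the labels, reduced along a ring homomorphism `φ`, is unchanged by every toggle. -/
lemma weightedSum_gToggle {V R : Type*} [Fintype V] [CommRing R] (G : SimpleGraph V) {m : ℕ}
    (φ : ZMod m →+* R) (c : V → R)
    (hc : ∀ v, (open Classical in ∑ w, if w = v ∨ G.Adj v w then c w else 0) = 0)
    (v : V) (lab : V → ZMod m) :
    ∑ w, c w * φ (gToggle G v lab w) = ∑ w, c w * φ (lab w) := by
  classical
  have key : ∀ w, c w * φ (gToggle G v lab w) =
      φ (lab v) * (if w = v ∨ G.Adj v w then c w else 0) + c w * φ (lab w) := by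
    intro w
    unfold gToggle
    split_ifs
    · rw [map_add]
      ring
    · ring
  simp only [key, Finset.sum_add_distrib, ← Finset.mul_sum]
  rw [hc v, mul_zero, zero_add]

lemma weightedSum_gPlay {V R : Type*} [Fintype V] [CommRing R] (G : SimpleGraph V) {m : ℕ}
    (φ : ZMod m →+* R) (c : V → R)
    (hc : ∀ v, (open Classical in ∑ w, if w = v ∨ G.Adj v w then c w else 0) = 0)
    (L : List V) (lab : V → ZMod m) :
    ∑ w, c w * φ (gPlay G L lab w) = ∑ w, c w * φ (lab w) := by
  induction L generalizing lab with
  | nil => rfl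
  | cons v L ih => exact (ih (gToggle G v lab)).trans (weightedSum_gToggle G φ c hc v lab)

/-- If the weights `c` sum to zero over every closed neighborhood and some weight is nonzero,
then `G` is not always winnable. -/
lemma not_gAW_of_weights {V R : Type*} [Fintype V] [CommRing R] (G : SimpleGraph V) {m : ℕ}
    (φ : ZMod m →+* R) (c : V → R)
    (hc : ∀ v, (open Classical in ∑ w, if w = v ∨ G.Adj v w then c w else 0) = 0)
    (u : V) (hu : c u ≠ 0) : ¬ gAW G m := by
  classical
  intro hAW
  obtain ⟨L, hL⟩ := hAW (Pi.single u 1)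
  have h := weightedSum_gPlay G φ c hc L (Pi.single u 1)
  rw [hL] at h
  exact hu (by simpa [Pi.single_apply, apply_ite φ] using h.symm)

/-- On a path with `n ≡ 2 (mod 3)` vertices, the weights `1, 1, 0, 1, 1, 0, …, 1, 1`
sum to zero modulo `2` over every closed neighborhood. -/
lemma pathGraph_sum_closedNeighborhood {n : ℕ} (hn : n % 3 = 2) (v : Fin n) :
    (open Classical in ∑ w : Fin n, if w = v ∨ (SimpleGraph.pathGraph n).Adj v w then
      (if w.val % 3 = 2 then (0 : ZMod 2) else 1) else 0) = 0 := by
  classical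
  obtain ⟨v, hv⟩ := v
  let f : ℕ → ZMod 2 := fun i =>
    (if i = v then (if v % 3 = 2 then 0 else 1) else 0) +
      (if i = v + 1 then (if (v + 1) % 3 = 2 then 0 else 1) else 0) +
      (if i = v - 1 then (if v = 0 ∨ (v - 1) % 3 = 2 then 0 else 1) else 0)
  have key : ∀ w : Fin n,
      (if w = ⟨v, hv⟩ ∨ (SimpleGraph.pathGraph n).Adj ⟨v, hv⟩ w then
        (if w.val % 3 = 2 then (0 : ZMod 2) else 1) else 0) = f w := by
    rintro ⟨w, hw⟩
    simp only [SimpleGraph.pathGraph_adj, Fin.mk.injEq, f]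
    grind
  have two : (1 : ZMod 2) + 1 = 0 := by decide
  rw [Finset.sum_congr rfl fun w _ => key w, Fin.sum_univ_eq_sum_range f n]
  simp only [f, Finset.sum_add_distrib, Finset.sum_ite_eq', Finset.mem_range]
  split_ifs <;> first | omega | simp [two]

theorem stmt10 (n k : ℕ) (hn : 1 ≤ n) (hk : 1 ≤ k)
    (hAW : gAW (SimpleGraph.pathGraph n) (2 ^ k)) :
    n % 3 = 0 ∨ n % 3 = 1 := by
  by_contra h
  have h2 : n % 3 = 2 := by omega
  exact not_gAW_of_weights _ (ZMod.castHom (dvd_pow_self 2 (by omega)) (ZMod 2))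
    (fun w : Fin n => if w.val % 3 = 2 then 0 else 1)
    (fun v => by convert pathGraph_sum_closedNeighborhood h2 v) ⟨0, hn⟩ (by simp) hAW
end

section
/- Let n ≥ 1 and consider the Z_2-labeling lights out game on the path graph P_n with vertices v_1, …, v_n. For any initial labeling of V(P_n) by Z_2, one can toggle vertices so as to achieve a labeling λ with λ(v_i) = 0 for all i ≥ 2. -/
theorem gPlay_append {V : Type*} (G : SimpleGraph V) {m : ℕ} (L M : List V)
    (lab : V → ZMod m) : gPlay G (L ++ M) lab = gPlay G M (gPlay G L lab) := by
  simp [gPlay]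

theorem gToggle_pathGraph {n m : ℕ} (v w : Fin n) (lab : Fin n → ZMod m) :
    gToggle (SimpleGraph.pathGraph n) v lab w =
      if w.val = v.val ∨ v.val + 1 = w.val ∨ w.val + 1 = v.val then lab v + lab w else lab w := by
  simp only [gToggle, SimpleGraph.pathGraph_adj, Fin.ext_iff]

/-- If the last lit vertex is `k + 1`, its light can be removed without lighting any later vertex:
toggle `k` if it is lit, and otherwise toggle `k + 1`, `k`, `k + 1` in turn. -/
theorem exists_gPlay_pathGraph_eq_zero_of_lt {n k : ℕ} (hk : k + 1 < n) (lab : Fin n → ZMod 2)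
    (hlit : lab ⟨k + 1, hk⟩ = 1) (h : ∀ i : Fin n, k + 1 < i.val → lab i = 0) :
    ∃ L : List (Fin n), ∀ i : Fin n, k < i.val →
      gPlay (SimpleGraph.pathGraph n) L lab i = 0 := by
  have htwo : (1 : ZMod 2) + 1 = 0 := rfl
  have hbit : ∀ x : ZMod 2, x = 0 ∨ x = 1 := by decide
  have hnear : ∀ i : Fin n, k < i.val → i = ⟨k + 1, hk⟩ ∨ i.val = k + 2 ∨ k + 2 < i.val := by
    intro i hi
    simp only [Fin.ext_iff]
    omega
  rcases hbit (lab ⟨k, by omega⟩) with h0 | h1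
  · refine ⟨[⟨k + 1, hk⟩, ⟨k, by omega⟩, ⟨k + 1, hk⟩], fun i hi => ?_⟩
    simp only [gPlay, List.foldl_cons, List.foldl_nil, gToggle_pathGraph]
    rcases hnear i hi with rfl | hi | hi
    · simp [h0, hlit, htwo]
    · have h1 : k + 2 + 1 ≠ k := by omega
      simp [h0, h1, hlit, htwo, hi, h i (by omega)]
    · have h1 : i.val ≠ k + 1 := by omega
      have h2 : k + 1 + 1 ≠ i.val := by omega
      have h3 : i.val + 1 ≠ k + 1 := by omega
      have h4 : i.val ≠ k := by omega
      have h5 : k + 1 ≠ i.val := by omega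
      have h6 : i.val + 1 ≠ k := by omega
      simp only [h1, h2, h3, h4, h5, h6, or_self, if_false, h i (by omega)]
  · refine ⟨[⟨k, by omega⟩], fun i hi => ?_⟩
    simp only [gPlay, List.foldl_cons, List.foldl_nil, gToggle_pathGraph]
    by_cases hik : i = ⟨k + 1, hk⟩
    · subst hik
      simp [h1, hlit, htwo]
    · rw [Fin.ext_iff] at hik
      rw [if_neg (by simp only at hik ⊢; omega), h i (by simp only at hik; omega)]

theorem exists_gPlay_pathGraph_eq_zero {n : ℕ} (k : ℕ) (lab : Fin n → ZMod 2)
    (h : ∀ i : Fin n, k < i.val → lab i = 0) :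
    ∃ L : List (Fin n), ∀ i : Fin n, 1 ≤ i.val →
      gPlay (SimpleGraph.pathGraph n) L lab i = 0 := by
  induction k generalizing lab with
  | zero => exact ⟨[], h⟩
  | succ k ih =>
    by_cases hlit : ∃ hk : k + 1 < n, lab ⟨k + 1, hk⟩ = 1
    · obtain ⟨hk, hlit⟩ := hlit
      obtain ⟨L, hL⟩ := exists_gPlay_pathGraph_eq_zero_of_lt hk lab hlit h
      obtain ⟨M, hM⟩ := ih _ hL
      exact ⟨L ++ M, by simpa only [gPlay_append] using hM⟩
    · refine ih lab fun i hi => ?_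
      have hbit : ∀ x : ZMod 2, x ≠ 1 → x = 0 := by decide
      rcases Nat.lt_or_eq_of_le (Nat.succ_le_of_lt hi) with hi | hi
      · exact h i hi
      · obtain ⟨i, hin⟩ := i
        obtain rfl : k + 1 = i := hi
        exact hbit _ fun h1 => hlit ⟨hin, h1⟩

theorem stmt12 (n : ℕ) (hn : 1 ≤ n) (lab : Fin n → ZMod 2) :
    ∃ L : List (Fin n), ∀ i : Fin n, 1 ≤ i.val →
      gPlay (SimpleGraph.pathGraph n) L lab i = 0 := by
  exact exists_gPlay_pathGraph_eq_zero n lab fun i hi => absurd i.isLt (by omega)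
end

section
/- Let n ≥ 1 with n ≡ 0 or 1 (mod 3). Then the path graph P_n is Z_2-AW. -/
theorem ZMod.two_eq_zero_or_eq_one : ∀ x : ZMod 2, x = 0 ∨ x = 1 := by decide

/-- Toggling the vertex `i` of the one-sided infinite path on `ℕ`. -/
def rayToggle (i : ℕ) (f : ℕ → ZMod 2) : ℕ → ZMod 2 :=
  fun j => if j = i ∨ j = i + 1 ∨ j + 1 = i then f i + f j else f j

/-- `g` can be reached from `f` on the infinite path by toggling vertices below `n`. -/
def RayReach (n : ℕ) : (ℕ → ZMod 2) → (ℕ → ZMod 2) → Prop :=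
  Relation.ReflTransGen fun f g => ∃ i < n, g = rayToggle i f

/-- The labeling that vanishes below `m`, takes the values `b, c, d, e` at `m, …, m + 3`,
and agrees with `f` from `m + 4` on. -/
def window (m : ℕ) (b c d e : ZMod 2) (f : ℕ → ZMod 2) : ℕ → ZMod 2 :=
  fun j => if j < m then 0 else if j = m then b else if j = m + 1 then c
    else if j = m + 2 then d else if j = m + 3 then e else f j

theorem RayReach.mono {m n : ℕ} (h : m ≤ n) {f g : ℕ → ZMod 2} (hr : RayReach m f g) :
    RayReach n f g :=
  Relation.ReflTransGen.mono (fun _ _ ⟨i, hi, hg⟩ => ⟨i, hi.trans_le h, hg⟩) _ _ hr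

theorem RayReach.toggle {n i : ℕ} (hi : i < n) (f : ℕ → ZMod 2) :
    RayReach n f (rayToggle i f) :=
  .single ⟨i, hi, rfl⟩

theorem RayReach.trans {n : ℕ} {f g h : ℕ → ZMod 2} (h₁ : RayReach n f g)
    (h₂ : RayReach n g h) : RayReach n f h :=
  Relation.ReflTransGen.trans h₁ h₂

theorem window_eq_self {m : ℕ} {f : ℕ → ZMod 2} (hf : ∀ j < m, f j = 0) :
    window m (f m) (f (m + 1)) (f (m + 2)) (f (m + 3)) f = f := by
  funext j
  grind [window]

theorem rayReach_window_add_one (m : ℕ) (b d e : ZMod 2) (f : ℕ → ZMod 2) :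
    RayReach (m + 3) (window m b 1 d e f) (window m (b + 1) 0 (d + 1) e f) := by
  have h11 : (1 : ZMod 2) + 1 = 0 := by decide
  convert RayReach.toggle (n := m + 3) (i := m + 1) (by omega) _ using 1
  funext j
  grind [window, rayToggle]

theorem rayReach_window_add_two (m : ℕ) (b c e : ZMod 2) (f : ℕ → ZMod 2) :
    RayReach (m + 3) (window m b c 1 e f) (window m b (c + 1) 0 (e + 1) f) := by
  have h11 : (1 : ZMod 2) + 1 = 0 := by decide
  convert RayReach.toggle (n := m + 3) (i := m + 2) (by omega) _ using 1
  funext j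
  grind [window, rayToggle]

/-- If `m` is the first lit vertex, it can be given the label `ε` and its right neighbor flipped,
leaving all other labels unchanged, by toggling vertices up to `m`. -/
def CanPass (m : ℕ) (ε : ZMod 2) : Prop :=
  ∀ c d e f, RayReach (m + 1) (window m 1 c d e f) (window m ε (c + 1) d e f)

theorem canPass_zero : CanPass 0 0 := by
  intro c d e f
  have h11 : (1 : ZMod 2) + 1 = 0 := by decide
  convert RayReach.toggle (n := 0 + 1) (i := 0) (by omega) _ using 1
  funext j
  grind [window, rayToggle]

theorem canPass_one : CanPass 1 1 := by
  intro c d e f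
  have h11 : (1 : ZMod 2) + 1 = 0 := by decide
  convert (RayReach.toggle (n := 1 + 1) (i := 1) (by omega) _).trans
    (RayReach.toggle (n := 1 + 1) (i := 0) (by omega) _) using 1
  funext j
  grind [window, rayToggle]

theorem CanPass.rayReach {m : ℕ} {ε : ZMod 2} (h : CanPass m ε) (c d e : ZMod 2)
    (f : ℕ → ZMod 2) :
    RayReach (m + 3) (window m 1 c d e f) (window m ε (c + 1) d e f) :=
  (h c d e f).mono (by omega)

theorem CanPass.rayReach_of_last {m : ℕ} {ε : ZMod 2} (h : CanPass m ε) (f : ℕ → ZMod 2) :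
    RayReach (m + 3) (window m 0 0 1 0 f) (window m 0 0 0 ε f) := by
  have h11 : (1 : ZMod 2) + 1 = 0 := by decide
  have hd := rayReach_window_add_two m 0 0 0 f
  have hc := rayReach_window_add_one m 0 0 1 f
  have hb := h.rayReach 0 1 1 f
  simp only [zero_add] at hd hc hb
  refine hd.trans (hc.trans (hb.trans ?_))
  obtain rfl | rfl := ZMod.two_eq_zero_or_eq_one ε
  · simpa [h11] using rayReach_window_add_two m 0 1 1 f
  · simpa [h11] using rayReach_window_add_one m 1 1 1 f

theorem CanPass.add_three {m : ℕ} {ε : ZMod 2} (h : CanPass m ε) : CanPass (m + 3) ε := by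
  intro c d e f
  have h11 : (1 : ZMod 2) + 1 = 0 := by decide
  have h₁ : rayToggle (m + 3) (window (m + 3) 1 c d e f) =
      window m 0 0 1 0 (window (m + 3) 0 (c + 1) d e f) := by
    funext j
    grind [window, rayToggle]
  have h₂ : window m 0 0 0 ε (window (m + 3) 0 (c + 1) d e f) =
      window (m + 3) ε (c + 1) d e f := by
    funext j
    grind [window]
  have h₃ := RayReach.toggle (n := m + 3 + 1) (i := m + 3) (by omega) (window (m + 3) 1 c d e f)
  rw [h₁] at h₃
  rw [← h₂]
  exact h₃.trans ((h.rayReach_of_last _).mono (by omega))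

theorem CanPass.exists_clear_window {m : ℕ} {ε : ZMod 2} (h : CanPass m ε) (b c d e : ZMod 2)
    (f : ℕ → ZMod 2) :
    ∃ e', RayReach (m + 3) (window m b c d e f) (window m 0 0 0 e' f) := by
  have h11 : (1 : ZMod 2) + 1 = 0 := by decide
  have step {x y : ℕ → ZMod 2} (hxy : RayReach (m + 3) x y)
      (hy : ∃ e', RayReach (m + 3) y (window m 0 0 0 e' f)) :
      ∃ e', RayReach (m + 3) x (window m 0 0 0 e' f) :=
    hy.imp fun _ => hxy.trans
  have hB (c d e) := h.rayReach c d e f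
  have hC (b d e) := rayReach_window_add_one m b d e f
  have hD (b c e) := rayReach_window_add_two m b c e f
  have w000 (e) : ∃ e', RayReach (m + 3) (window m 0 0 0 e f) (window m 0 0 0 e' f) :=
    ⟨e, .refl⟩
  have w111 (e) : ∃ e', RayReach (m + 3) (window m 1 1 1 e f) (window m 0 0 0 e' f) :=
    step (hC 1 1 e) (by simpa [h11] using w000 e)
  have w011 (e) : ∃ e', RayReach (m + 3) (window m 0 1 1 e f) (window m 0 0 0 e' f) :=
    step (hD 0 1 e) (by simpa [h11] using w000 (e + 1))
  have w101 (e) : ∃ e', RayReach (m + 3) (window m 1 0 1 e f) (window m 0 0 0 e' f) := by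
    refine step (hB 0 1 e) ?_
    obtain rfl | rfl := ZMod.two_eq_zero_or_eq_one ε
    · simpa using w011 e
    · simpa using w111 e
  have w010 (e) : ∃ e', RayReach (m + 3) (window m 0 1 0 e f) (window m 0 0 0 e' f) :=
    step (hC 0 0 e) (by simpa using w101 e)
  have w001 (e) : ∃ e', RayReach (m + 3) (window m 0 0 1 e f) (window m 0 0 0 e' f) :=
    step (hD 0 0 e) (by simpa using w010 (e + 1))
  have w110 (e) : ∃ e', RayReach (m + 3) (window m 1 1 0 e f) (window m 0 0 0 e' f) :=
    step (hC 1 0 e) (by simpa [h11] using w001 e)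
  have w100 (e) : ∃ e', RayReach (m + 3) (window m 1 0 0 e f) (window m 0 0 0 e' f) := by
    refine step (hB 0 0 e) ?_
    obtain rfl | rfl := ZMod.two_eq_zero_or_eq_one ε
    · simpa using w010 e
    · simpa using w110 e
  obtain rfl | rfl := ZMod.two_eq_zero_or_eq_one b <;>
    obtain rfl | rfl := ZMod.two_eq_zero_or_eq_one c <;>
    obtain rfl | rfl := ZMod.two_eq_zero_or_eq_one d
  exacts [w000 e, w001 e, w010 e, w011 e, w100 e, w101 e, w110 e, w111 e]

/-- Every labeling of the infinite path can be made to vanish below `n` by toggles below `n`. -/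
def CanClear (n : ℕ) : Prop :=
  ∀ f, ∃ g, RayReach n f g ∧ ∀ j < n, g j = 0

theorem canClear_zero : CanClear 0 := fun f => ⟨f, .refl, by simp⟩

theorem canClear_one : CanClear 1 := by
  intro f
  obtain h | h := ZMod.two_eq_zero_or_eq_one (f 0)
  · exact ⟨f, .refl, by simpa using h⟩
  · refine ⟨_, RayReach.toggle (i := 0) (by omega) f, fun j hj => ?_⟩
    obtain rfl : j = 0 := by omega
    simp only [rayToggle, true_or, if_true, h]
    decide

theorem CanClear.add_three {m : ℕ} {ε : ZMod 2} (hm : CanClear m) (h : CanPass m ε) :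
    CanClear (m + 3) := by
  intro f
  obtain ⟨g, hfg, hg⟩ := hm f
  obtain ⟨e', he⟩ := h.exists_clear_window (g m) (g (m + 1)) (g (m + 2)) (g (m + 3)) g
  rw [window_eq_self hg] at he
  exact ⟨_, (hfg.mono (by omega)).trans he, fun j hj => by grind [window]⟩

theorem canClear_of_mod_three (n : ℕ) (h3 : n % 3 = 0 ∨ n % 3 = 1) : CanClear n := by
  have h0 (k : ℕ) : CanClear (3 * k) ∧ CanPass (3 * k) 0 := by
    induction k with
    | zero => exact ⟨canClear_zero, canPass_zero⟩
    | succ k ih => exact ⟨ih.1.add_three ih.2, ih.2.add_three⟩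
  have h1 (k : ℕ) : CanClear (3 * k + 1) ∧ CanPass (3 * k + 1) 1 := by
    induction k with
    | zero => exact ⟨canClear_one, canPass_one⟩
    | succ k ih => exact ⟨ih.1.add_three ih.2, ih.2.add_three⟩
  obtain h | h := h3
  · have := (h0 (n / 3)).1
    rwa [show 3 * (n / 3) = n by omega] at this
  · have := (h1 (n / 3)).1
    rwa [show 3 * (n / 3) + 1 = n by omega] at this

theorem gToggle_pathGraph_restrict {n : ℕ} (i : Fin n) (f : ℕ → ZMod 2) :
    gToggle (SimpleGraph.pathGraph n) i (fun j : Fin n => f j) =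
      fun j : Fin n => rayToggle i f j := by
  funext j
  simp only [gToggle, rayToggle, SimpleGraph.pathGraph_adj, Fin.ext_iff]
  grind

theorem RayReach.exists_gPlay {n : ℕ} {f g : ℕ → ZMod 2} (h : RayReach n f g) :
    ∃ L, gPlay (SimpleGraph.pathGraph n) L (fun j : Fin n => f j) = fun j : Fin n => g j := by
  induction h using Relation.ReflTransGen.head_induction_on with
  | refl => exact ⟨[], rfl⟩
  | head hstep _ ih =>
    obtain ⟨i, hi, rfl⟩ := hstep
    obtain ⟨L, hL⟩ := ih
    refine ⟨⟨i, hi⟩ :: L, ?_⟩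
    rw [← hL, ← gToggle_pathGraph_restrict ⟨i, hi⟩]
    rfl

theorem stmt14 (n : ℕ) (hn : 1 ≤ n) (h3 : n % 3 = 0 ∨ n % 3 = 1) :
    gAW (SimpleGraph.pathGraph n) 2 := by
  intro lab
  obtain ⟨g, hr, hg⟩ := canClear_of_mod_three n h3 fun j => if h : j < n then lab ⟨j, h⟩ else 0
  obtain ⟨L, hL⟩ := hr.exists_gPlay
  refine ⟨L, ?_⟩
  simp only [Fin.is_lt, dif_pos, Fin.eta] at hL
  rw [hL]
  funext j
  exact hg j j.is_lt
end

section
/- Let n ≥ 3 with n ≡ 1 or 2 (mod 3). Then the cycle graph C_n is Z_2-AW. -/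
namespace LightsOutCycle

variable {n : ℕ}

/-- The labeling with a single nonzero label, at the vertex `a`. -/
def pulse (a : ZMod n) : ZMod n → ZMod 2 := Pi.single a 1

theorem pulse_self (a : ZMod n) : pulse a a = 1 := by simp [pulse]

theorem pulse_of_ne {a b : ZMod n} (h : b ≠ a) : pulse a b = 0 := by simp [pulse, h]

theorem add_natCast_ne (i : ZMod n) {a b : ℕ} (ha : a < n) (hb : b < n) (hab : a ≠ b) :
    i + a ≠ i + b := by
  intro h
  rw [add_right_inj, ZMod.natCast_eq_natCast_iff'] at h
  rw [Nat.mod_eq_of_lt ha, Nat.mod_eq_of_lt hb] at h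
  exact hab h

theorem pulse_add_natCast (i : ZMod n) {a b : ℕ} (ha : a < n) (hb : b < n) :
    pulse (i + (a : ZMod n)) (i + (b : ZMod n)) = if a = b then 1 else 0 := by
  split_ifs with h
  · subst h; exact pulse_self _
  · exact pulse_of_ne (add_natCast_ne i hb ha (Ne.symm h))

/-- `G` is the cycle on `ZMod n`. -/
def IsCycleOn (G : SimpleGraph (ZMod n)) : Prop :=
  ∀ u v, G.Adj u v ↔ u + 1 = v ∨ v + 1 = u

variable {G : SimpleGraph (ZMod n)}

theorem two_eq_zero : (2 : ZMod 2) = 0 := rfl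

theorem eq_zero_or_one (x : ZMod 2) : x = 0 ∨ x = 1 := by
  revert x; decide

/-- Toggling the lit vertex `v`, whose neighbors are `a` and `b`. -/
theorem winnable_of_toggle (hG : IsCycleOn G) (hn : 4 ≤ n) {l : ZMod n → ZMod 2}
    {a v b : ZMod n} (ha : a + 1 = v) (hb : v + 1 = b) (hv : l v = 1)
    (h : gWinnable G (l + pulse a + pulse v + pulse b)) : gWinnable G l := by
  have key : gToggle G v l = l + pulse a + pulse v + pulse b := by
    subst ha hb
    have h01 := add_natCast_ne a (a := 0) (b := 1) (by lia) (by lia) (by lia)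
    have h02 := add_natCast_ne a (a := 0) (b := 2) (by lia) (by lia) (by lia)
    have h12 := add_natCast_ne a (a := 1) (b := 2) (by lia) (by lia) (by lia)
    have e2 : a + 1 + 1 = a + 2 := by ring
    push_cast at h01 h02 h12
    rw [add_zero] at h01 h02
    funext w
    simp only [gToggle, hG (a + 1) w, hv, Pi.add_apply, e2, pulse, Pi.single_apply,
      add_left_inj]
    by_cases w0 : w = a
    · subst w0; simp [h01, h02, add_comm]
    by_cases w1 : w = a + 1
    · subst w1; simp [h01.symm, h12, add_comm]
    by_cases w2 : w = a + 2
    · subst w2; simp [h02.symm, h12.symm, add_comm]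
    simp [w0, w1, w2, Ne.symm w2]
  obtain ⟨L, hL⟩ := h
  refine ⟨v :: L, ?_⟩
  rw [← key] at hL
  exact hL

/-- A lit vertex with two unlit vertices below it can be moved down by three. -/
theorem winnable_of_shift (hG : IsCycleOn G) (hn : 4 ≤ n) {l : ZMod n → ZMod 2}
    (i : ZMod n) (h1 : l (i + 1) = 0) (h2 : l (i + 2) = 0) (h3 : l (i + 3) = 1)
    (h : gWinnable G (l + pulse (i + 3) + pulse i)) : gWinnable G l := by
  have E := fun (a b : ℕ) (ha : a < n) (hb : b < n) => pulse_add_natCast i ha hb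
  have e12 := E 1 2 (by lia) (by lia)
  have e13 := E 1 3 (by lia) (by lia)
  have e21 := E 2 1 (by lia) (by lia)
  have e23 := E 2 3 (by lia) (by lia)
  have e31 := E 3 1 (by lia) (by lia)
  have e32 := E 3 2 (by lia) (by lia)
  have e41 : pulse (i + 3 + 1) (i + 1) = 0 := by
    have := pulse_add_natCast (i + 1) (a := 3) (b := 0) (by lia) (by lia)
    convert this using 2 <;> push_cast <;> ring
  have e42 : pulse (i + 3 + 1) (i + 2) = 0 := by
    have := pulse_add_natCast (i + 1) (a := 3) (b := 1) (by lia) (by lia)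
    convert this using 2 <;> push_cast <;> ring
  have e43 : pulse (i + 3 + 1) (i + 3) = 0 := by
    have := pulse_add_natCast (i + 1) (a := 3) (b := 2) (by lia) (by lia)
    convert this using 2 <;> push_cast <;> ring
  norm_num at e12 e13 e21 e23 e31 e32
  refine winnable_of_toggle hG hn (v := i + 3) (a := i + 2) (by ring) rfl h3 ?_
  refine winnable_of_toggle hG hn (v := i + 2) (a := i + 1) (b := i + 3) (by ring) (by ring) ?_ ?_
  · simp [*, pulse_self]
  refine winnable_of_toggle hG hn (v := i + 3) (a := i + 2) (by ring) rfl ?_ ?_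
  · simp only [Pi.add_apply, *, pulse_self]; decide
  refine winnable_of_toggle hG hn (v := i + 1) (a := i) (b := i + 2) rfl (by ring) ?_ ?_
  · simp only [Pi.add_apply, *, pulse_self]; decide
  convert h using 1
  funext w
  simp only [Pi.add_apply]
  linear_combination (pulse (i + 3) w + 2 * pulse (i + 2) w + pulse (i + 1) w
    + pulse (i + 3 + 1) w) * two_eq_zero

/-- If `i + 1` is lit and `i + 2` is not, the labels of `i` and `i + 3` can be flipped. -/
theorem winnable_of_gap_one (hG : IsCycleOn G) (hn : 4 ≤ n) {l : ZMod n → ZMod 2}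
    (i : ZMod n) (h1 : l (i + 1) = 1) (h2 : l (i + 2) = 0)
    (h : gWinnable G (l + pulse (i + 3) + pulse i)) : gWinnable G l := by
  have E := fun (a b : ℕ) (ha : a < n) (hb : b < n) => pulse_add_natCast i ha hb
  have e02 := E 0 2 (by lia) (by lia)
  have e12 := E 1 2 (by lia) (by lia)
  norm_num at e02 e12
  refine winnable_of_toggle hG hn (v := i + 1) (a := i) (b := i + 2) rfl (by ring) h1 ?_
  refine winnable_of_toggle hG hn (v := i + 2) (a := i + 1) (b := i + 3) (by ring) (by ring) ?_ ?_
  · simp [*, pulse_self]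
  convert h using 1
  funext w
  simp only [Pi.add_apply]
  linear_combination (pulse (i + 2) w + pulse (i + 1) w) * two_eq_zero

/-- Two lit vertices at a distance divisible by three, with only unlit vertices between,
cancel. -/
theorem winnable_of_add_pulses (hG : IsCycleOn G) (hn : 4 ≤ n) {f : ZMod n → ZMod 2}
    (hf : gWinnable G f) (j : ZMod n) (k : ℕ) (hk : 3 * k < n)
    (h0 : ∀ m : ℕ, 1 ≤ m → m ≤ 3 * k → f (j + m) = 0) :
    gWinnable G (f + pulse j + pulse (j + ((3 * k : ℕ) : ZMod n))) := by
  induction k with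
  | zero =>
    convert hf using 1
    funext w
    simp only [Pi.add_apply, mul_zero, Nat.cast_zero, add_zero]
    linear_combination pulse j w * two_eq_zero
  | succ k ih =>
    have val : ∀ m : ℕ, 1 ≤ m → m ≤ 3 * (k + 1) →
        (f + pulse j + pulse (j + ((3 * (k + 1) : ℕ) : ZMod n))) (j + (m : ZMod n)) =
          if 3 * (k + 1) = m then 1 else 0 := by
      intro m hm hm'
      have h1 := pulse_add_natCast j (a := 0) (b := m) (by lia) (by lia)
      rw [Nat.cast_zero, add_zero, if_neg (by lia)] at h1
      rw [Pi.add_apply, Pi.add_apply, h0 m hm hm', h1,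
        pulse_add_natCast j hk (by lia), zero_add, zero_add]
    have c1 : j + ((3 * k : ℕ) : ZMod n) + 1 = j + (3 * k + 1 : ℕ) := by push_cast; ring
    have c2 : j + ((3 * k : ℕ) : ZMod n) + 2 = j + (3 * k + 2 : ℕ) := by push_cast; ring
    have c3 : j + ((3 * k : ℕ) : ZMod n) + 3 = j + (3 * (k + 1) : ℕ) := by push_cast; ring
    refine winnable_of_shift hG hn (j + ((3 * k : ℕ) : ZMod n)) ?_ ?_ ?_ ?_
    · rw [c1, val _ (by lia) (by lia), if_neg (by lia)]
    · rw [c2, val _ (by lia) (by lia), if_neg (by lia)]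
    · rw [c3, val _ (by lia) (by lia), if_pos rfl]
    · rw [c3]
      convert ih (by lia) (fun m h h' => h0 m h (by lia)) using 1
      funext w
      simp only [Pi.add_apply]
      linear_combination pulse (j + ((3 * (k + 1) : ℕ) : ZMod n)) w * two_eq_zero

theorem winnable_zero : gWinnable G (0 : ZMod n → ZMod 2) := ⟨[], rfl⟩

theorem winnable_three_pulses (hG : IsCycleOn G) (hn : 4 ≤ n) (i : ZMod n) :
    gWinnable G (pulse i + pulse (i + 1) + pulse (i + 2)) := by
  have E := fun (a b : ℕ) (ha : a < n) (hb : b < n) => pulse_add_natCast i ha hb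
  have e01 := E 0 1 (by lia) (by lia)
  have e21 := E 2 1 (by lia) (by lia)
  norm_num at e01 e21
  refine winnable_of_toggle hG hn (v := i + 1) (a := i) (b := i + 2) rfl (by ring) ?_ ?_
  · simp [*, pulse_self]
  convert winnable_zero (G := G) using 1
  funext w
  simp only [Pi.add_apply, Pi.zero_apply]
  linear_combination (pulse i w + pulse (i + 1) w + pulse (i + 2) w) * two_eq_zero

/-- A single lit vertex is winnable when `3` does not divide `n`. -/
theorem winnable_pulse (hG : IsCycleOn G) (hn : 4 ≤ n) (h3 : n % 3 = 1 ∨ n % 3 = 2)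
    (i : ZMod n) : gWinnable G (pulse i) := by
  refine winnable_of_toggle hG hn (v := i) (a := i - 1) (by ring) rfl (pulse_self i) ?_
  rcases h3 with h3 | h3
  · have hlit : pulse i (i - 1) = 0 := by
      have := pulse_add_natCast (i - 1) (a := 1) (b := 0) (by lia) (by lia)
      norm_num at this; exact this
    have hlit' : pulse (i + 1) (i - 1) = 0 := by
      have := pulse_add_natCast (i - 1) (a := 2) (b := 0) (by lia) (by lia)
      convert this using 2 <;> push_cast <;> ring
    refine winnable_of_toggle hG hn (v := i - 1) (a := i - 2) (b := i) (by ring) (by ring) ?_ ?_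
    · simp [*, pulse_self]
    obtain ⟨k, hk⟩ : ∃ k, n = 3 * k + 4 := ⟨(n - 4) / 3, by lia⟩
    convert winnable_of_add_pulses hG hn (winnable_three_pulses hG hn i) (i + 2) k (by lia) ?_
      using 1
    · have : i + 2 + ((3 * k : ℕ) : ZMod n) = i - 2 := by
        have hcast : ((3 * k + 4 : ℕ) : ZMod n) = 0 := by rw [← hk]; exact ZMod.natCast_self n
        push_cast at hcast ⊢
        linear_combination hcast
      rw [this]
      funext w
      simp only [Pi.add_apply]
      linear_combination (pulse i w + pulse (i - 1) w - pulse (i + 2) w) * two_eq_zero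
    · intro m hm hm'
      have q0 := pulse_add_natCast i (a := 0) (b := 2 + m) (by lia) (by lia)
      have q1 := pulse_add_natCast i (a := 1) (b := 2 + m) (by lia) (by lia)
      have q2 := pulse_add_natCast i (a := 2) (b := 2 + m) (by lia) (by lia)
      rw [if_neg (by lia)] at q0 q1 q2
      push_cast at q0 q1 q2
      simp only [add_zero, ← add_assoc] at q0 q1 q2
      simp [q0, q1, q2]
  · obtain ⟨k, hk⟩ : ∃ k, n = 3 * k + 2 := ⟨(n - 2) / 3, by lia⟩
    convert winnable_of_add_pulses hG hn winnable_zero (i + 1) k (by lia) (fun _ _ _ => rfl)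
      using 1
    have : i + 1 + ((3 * k : ℕ) : ZMod n) = i - 1 := by
      have hcast : ((3 * k + 2 : ℕ) : ZMod n) = 0 := by rw [← hk]; exact ZMod.natCast_self n
      push_cast at hcast ⊢
      linear_combination hcast
    rw [this]
    funext w
    simp only [Pi.add_apply, Pi.zero_apply]
    linear_combination pulse i w * two_eq_zero

/-- Labelings supported on three consecutive vertices are winnable when `3` does not
divide `n`. -/
theorem winnable_of_window (hG : IsCycleOn G) (hn : 4 ≤ n) (h3 : n % 3 = 1 ∨ n % 3 = 2)
    {l : ZMod n → ZMod 2} (hl : ∀ m : ℕ, 3 ≤ m → m < n → l m = 0) : gWinnable G l := by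
  have E := fun (a b : ℕ) (ha : a < n) (hb : b < n) => pulse_add_natCast (n := n) 0 ha hb
  have : NeZero n := ⟨by lia⟩
  have decomp : l = fun w => l 0 * pulse 0 w + l 1 * pulse 1 w + l 2 * pulse 2 w := by
    funext w
    obtain ⟨m, hm, rfl⟩ : ∃ m : ℕ, m < n ∧ (m : ZMod n) = w :=
      ⟨w.val, w.val_lt, ZMod.natCast_zmod_val w⟩
    have q0 := E 0 m (by lia) hm
    have q1 := E 1 m (by lia) hm
    have q2 := E 2 m (by lia) hm
    push_cast at q0 q1 q2
    simp only [zero_add] at q0 q1 q2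
    rw [q0, q1, q2]
    rcases (by lia : m = 0 ∨ m = 1 ∨ m = 2 ∨ 3 ≤ m) with rfl | rfl | rfl | h
    · simp
    · simp
    · simp
    · rw [hl m h hm]
      simp [show 0 ≠ m by lia, show 1 ≠ m by lia, show 2 ≠ m by lia]
  have e01 := E 0 1 (by lia) (by lia)
  have e10 := E 1 0 (by lia) (by lia)
  have e02 := E 0 2 (by lia) (by lia)
  have e20 := E 2 0 (by lia) (by lia)
  have e12 := E 1 2 (by lia) (by lia)
  have e21 := E 2 1 (by lia) (by lia)
  norm_num at e01 e10 e02 e20 e12 e21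
  have single := winnable_pulse hG hn h3
  have w101 : gWinnable G (pulse (0 : ZMod n) + pulse 2) := by
    have e_neg := pulse_add_natCast (n := n) (-1) (a := 0) (b := 1) (by lia) (by lia)
    norm_num at e_neg
    refine winnable_of_gap_one hG hn (-1) ?_ ?_ ?_
    · norm_num [*, pulse_self]
    · norm_num [*, pulse_self]
    refine winnable_of_toggle hG hn (v := 0) (a := -1) (b := 1) (by ring) (by ring) ?_ ?_
    · norm_num [*, pulse_self]
    convert single 1 using 1
    funext w
    norm_num
    linear_combination (pulse 0 w + pulse 2 w + pulse (-1) w) * two_eq_zero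
  rw [decomp]
  rcases eq_zero_or_one (l 0) with x0 | x0 <;> rcases eq_zero_or_one (l 1) with x1 | x1 <;>
    rcases eq_zero_or_one (l 2) with x2 | x2 <;>
    simp only [x0, x1, x2, zero_mul, one_mul, zero_add, add_zero]
  · exact winnable_zero
  · exact single 2
  · exact single 1
  · refine winnable_of_toggle hG hn (v := 1) (a := 0) (b := 2) (by ring) (by ring) ?_ ?_
    · simp [*, pulse_self]
    convert single 0 using 1
    funext w
    simp only [Pi.add_apply]
    linear_combination (pulse 1 w + pulse 2 w) * two_eq_zero
  · exact single 0
  · exact w101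
  · refine winnable_of_toggle hG hn (v := 1) (a := 0) (b := 2) (by ring) (by ring) ?_ ?_
    · simp [*, pulse_self]
    convert single 2 using 1
    funext w
    simp only [Pi.add_apply]
    linear_combination (pulse 0 w + pulse 1 w) * two_eq_zero
  · convert winnable_three_pulses hG hn 0 using 1
    funext w
    simp

/-- Labelings vanishing from position `p + 3` on are winnable: the topmost lit vertex can
always be cleared using only the three vertices below it. -/
theorem winnable_of_support (hG : IsCycleOn G) (hn : 4 ≤ n) (h3 : n % 3 = 1 ∨ n % 3 = 2)
    (p : ℕ) (hp : p + 3 ≤ n) {l : ZMod n → ZMod 2}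
    (hl : ∀ m : ℕ, p + 3 ≤ m → m < n → l m = 0) : gWinnable G l := by
  induction p generalizing l with
  | zero => exact winnable_of_window hG hn h3 (by simpa using hl)
  | succ p ih =>
    have val := fun (a b : ℕ) (ha : a < n) (hb : b < n) =>
      pulse_add_natCast (n := n) 0 ha hb
    simp only [zero_add] at val
    have c1 : ((p + 1 : ℕ) : ZMod n) = p + 1 := by push_cast; ring
    have c2 : ((p + 2 : ℕ) : ZMod n) = p + 2 := by push_cast; ring
    have c3 : ((p + 3 : ℕ) : ZMod n) = p + 3 := by push_cast; ring
    rcases eq_zero_or_one (l (p + 3)) with x3 | x3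
    · refine ih (by lia) fun m hm hm' => ?_
      rcases hm.eq_or_lt with rfl | hlt
      · rw [c3, x3]
      · exact hl m (by lia) hm'
    have cleared : gWinnable G (l + pulse ((p : ZMod n) + 3) + pulse (p : ZMod n)) := by
      refine ih (by lia) fun m hm hm' => ?_
      rw [← c3, Pi.add_apply, Pi.add_apply, val _ _ (by lia) hm', val _ _ (by lia) hm',
        if_neg (show p ≠ m by lia), add_zero]
      rcases hm.eq_or_lt with rfl | hlt
      · rw [c3, x3, if_pos rfl]; rfl
      · rw [hl m (by lia) hm', if_neg (by lia), add_zero]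
    rcases eq_zero_or_one (l (p + 2)) with x2 | x2
    · rcases eq_zero_or_one (l (p + 1)) with x1 | x1
      · exact winnable_of_shift hG hn _ x1 x2 x3 cleared
      · exact winnable_of_gap_one hG hn _ x1 x2 cleared
    · refine winnable_of_toggle hG hn (v := (p : ZMod n) + 2) (a := p + 1) (b := p + 3)
        (by ring) (by ring) x2 (ih (by lia) fun m hm hm' => ?_)
      rw [← c1, ← c2, ← c3]
      simp only [Pi.add_apply]
      rw [val _ _ (by lia) hm', val _ _ (by lia) hm', val _ _ (by lia) hm',
        if_neg (show p + 1 ≠ m by lia), if_neg (show p + 2 ≠ m by lia), add_zero, add_zero]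
      rcases hm.eq_or_lt with rfl | hlt
      · rw [c3, x3, if_pos rfl]; rfl
      · rw [hl m (by lia) hm', if_neg (by lia), add_zero]

theorem gAW_two_of_isCycleOn (hG : IsCycleOn G) (hn : 4 ≤ n) (h3 : n % 3 = 1 ∨ n % 3 = 2) :
    gAW G 2 := fun _ =>
  winnable_of_support hG hn h3 (n - 3) (by lia) fun _ _ _ => by lia

end LightsOutCycle

theorem stmt15 (n : ℕ) (hn : 3 ≤ n) (h3 : n % 3 = 1 ∨ n % 3 = 2) :
    gAW (SimpleGraph.cycleGraph n) 2 := by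
  obtain ⟨k, rfl⟩ : ∃ k, n = k + 2 := ⟨n - 2, by lia⟩
  refine LightsOutCycle.gAW_two_of_isCycleOn (n := k + 2) (fun u v => ?_) (by lia) h3
  refine SimpleGraph.cycleGraph_adj.trans ?_
  rw [or_comm]
  refine or_congr ?_ ?_
  · exact sub_eq_iff_eq_add'.trans eq_comm
  · exact sub_eq_iff_eq_add'.trans eq_comm
end

section
/- Let n, p ≥ 1 and suppose at least one of n and p is even. Then the complete bipartite graph K_{n,p} is Z_2-AW. -/
theorem gWinnable_of_gToggle {V : Type*} {G : SimpleGraph V} {m : ℕ} {lab : V → ZMod m} (v : V)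
    (h : gWinnable G (gToggle G v lab)) : gWinnable G lab := by
  obtain ⟨L, hL⟩ := h
  exact ⟨v :: L, hL⟩

/-- The number of elements at which a `ZMod 2`-valued function takes the value `1`. -/
def onesCount {α : Type*} [Fintype α] (f : α → ZMod 2) : ℕ :=
  (Finset.univ.filter fun i => f i = 1).card

section OnesCount

variable {α : Type*} [Fintype α] {f g : α → ZMod 2}

theorem onesCount_le_card : onesCount f ≤ Fintype.card α := Finset.card_le_univ _

theorem eq_zero_of_onesCount_eq_zero (h : onesCount f = 0) (i : α) : f i = 0 := by
  have hi : f i ≠ 1 := by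
    simpa using Finset.filter_eq_empty_iff.1 (Finset.card_eq_zero.1 h) (Finset.mem_univ i)
  generalize f i = x at hi
  revert x
  decide

theorem exists_eq_one_of_onesCount_pos (h : 0 < onesCount f) : ∃ i, f i = 1 := by
  obtain ⟨i, hi⟩ := Finset.card_pos.1 h
  exact ⟨i, (Finset.mem_filter.1 hi).2⟩

/-- Adding `1` everywhere complements the set of ones. -/
theorem onesCount_one_add (h : ∀ i, g i = 1 + f i) :
    onesCount g = Fintype.card α - onesCount f := by
  classical
  have key : ∀ x : ZMod 2, 1 + x = 1 ↔ ¬ x = 1 := by decide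
  simp only [onesCount, h, key]
  rw [← Finset.compl_filter, Finset.card_compl]

/-- Replacing a single `1` by `0` lowers the number of ones by one. -/
theorem onesCount_of_clear {i : α} (hf : f i = 1) (hg : g i = 0)
    (h : ∀ j, j ≠ i → g j = f j) : onesCount g = onesCount f - 1 := by
  classical
  have hfilter : (Finset.univ.filter fun j => g j = 1)
      = (Finset.univ.filter fun j => f j = 1).erase i := by
    ext j
    by_cases hj : j = i
    · subst hj; simp [hg]
    · simp [hj, h j hj]
  rw [onesCount, hfilter, Finset.card_erase_of_mem (by simp [hf]), onesCount]

end OnesCount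

section Counting

variable {n p : ℕ} {W : ℕ → ℕ → Prop}

/-- Clearing all `a` ones of one part, each move complementing the other part. -/
theorem clear_first (step : ∀ a b, b ≤ p → W a (p - b) → W (a + 1) b) {a b : ℕ} (hb : b ≤ p)
    (h : W 0 (if Even a then b else p - b)) : W a b := by
  induction a generalizing b with
  | zero => simpa using h
  | succ a ih =>
    refine step a b hb (ih (Nat.sub_le _ _) ?_)
    by_cases ha : Even a
    · simpa [ha, Nat.even_add_one] using h
    · simpa [ha, Nat.even_add_one, Nat.sub_sub_self hb] using h

/-- The lights out game on a complete bipartite graph, in terms of the number of ones in each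
part: every position wins when one of the parts has even size. -/
theorem win_of_steps (h00 : W 0 0) (hpar : Even n ∨ Even p)
    (stepL : ∀ a b, b ≤ p → W a (p - b) → W (a + 1) b)
    (stepR : ∀ a b, a ≤ n → W (n - a) b → W a (b + 1)) {a b : ℕ} (hb : b ≤ p) : W a b := by
  have clearR : ∀ {a b : ℕ}, a ≤ n → W (if Even b then a else n - a) 0 → W a b :=
    fun ha h => clear_first (W := flip W) (fun b a => stepR a b) ha h
  have even_right : ∀ b, Even b → W 0 b := fun b hb => clearR (Nat.zero_le n) (by simpa [hb])
  have zero_left : ∀ b ≤ p, W 0 b := by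
    intro b hb
    by_cases hbe : Even b
    · exact even_right b hbe
    by_cases hne : Even n
    · exact clearR (Nat.zero_le n) (by
        simpa [hbe] using clear_first stepL (Nat.zero_le p) (by simpa [hne]))
    · have hpe := hpar.resolve_left hne
      obtain ⟨c, rfl⟩ : ∃ c, b = c + 1 :=
        Nat.exists_eq_succ_of_ne_zero (by rintro rfl; exact hbe Even.zero)
      have hc : Even c := by simpa [Nat.even_add_one] using hbe
      refine stepR 0 c (Nat.zero_le n) (clear_first stepL (by omega) ?_)
      simp only [Nat.sub_zero, hne, if_false]
      exact even_right _ ((Nat.even_sub (by omega)).2 (by simp [hpe, hc]))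
  exact clear_first stepL hb (zero_left _ (by split_ifs <;> omega))

end Counting

theorem gAW_completeBipartiteGraph {α β : Type*} [Fintype α] [Fintype β]
    (h : Even (Fintype.card α) ∨ Even (Fintype.card β)) :
    gAW (completeBipartiteGraph α β) 2 := by
  intro lab
  refine win_of_steps (n := Fintype.card α) (p := Fintype.card β)
    (W := fun a b => ∀ lab : α ⊕ β → ZMod 2, onesCount (fun i => lab (.inl i)) = a →
      onesCount (fun j => lab (.inr j)) = b → gWinnable (completeBipartiteGraph α β) lab)
    ?_ h ?_ ?_ onesCount_le_card lab rfl rfl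
  · intro lab ha hb
    refine ⟨[], funext ?_⟩
    rintro (i | j)
    · exact eq_zero_of_onesCount_eq_zero ha i
    · exact eq_zero_of_onesCount_eq_zero hb j
  · intro a b _ ih lab ha hb
    obtain ⟨i, hi⟩ := exists_eq_one_of_onesCount_pos (a.succ_pos.trans_eq ha.symm)
    refine gWinnable_of_gToggle (.inl i) (ih _ ?_ ?_)
    · rw [onesCount_of_clear (f := fun i => lab (.inl i)) hi, ha, Nat.add_sub_cancel]
      · simp [gToggle, hi, CharTwo.add_self_eq_zero]
      · intro j hj
        simp [gToggle, hj]
    · rw [← hb]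
      exact onesCount_one_add fun j => by simp [gToggle, hi]
  · intro a b _ ih lab ha hb
    obtain ⟨j, hj⟩ := exists_eq_one_of_onesCount_pos (b.succ_pos.trans_eq hb.symm)
    refine gWinnable_of_gToggle (.inr j) (ih _ ?_ ?_)
    · rw [← ha]
      exact onesCount_one_add fun i => by simp [gToggle, hj]
    · rw [onesCount_of_clear (f := fun j => lab (.inr j)) hj, hb, Nat.add_sub_cancel]
      · simp [gToggle, hj, CharTwo.add_self_eq_zero]
      · intro i hi
        simp [gToggle, hi]

theorem stmt16 (n p : ℕ) (hn : 1 ≤ n) (hp : 1 ≤ p) (h : Even n ∨ Even p) :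
    gAW (completeBipartiteGraph (Fin n) (Fin p)) 2 :=
  gAW_completeBipartiteGraph (by simpa using h)
end
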